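/- Let K ⊂ ℝ³ be a smooth strictly convex centrally symmetric body equipartitioned by the standard orthonormal basis. Then for each octant ω ∈ {−1,1}³, the vector V((∂K)(ω)) = ∫_{(∂K)(ω)} n_K dH equals (1/4)·Σ_{i=1}^3 |K ∩ e_i^⊥| ω_i e_i. -/

import Mathlib

open MeasureTheory
open scoped RealInnerProductSpace

noncomputable def pl (b : OrthonormalBasis (Fin 3) ℝ (EuclideanSpace ℝ (Fin 3))) :
    EuclideanSpace ℝ (Fin 2) →ₗ[ℝ] EuclideanSpace ℝ (Fin 3) where
  toFun w := w 0 • b 1 + w 1 • b 2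
  map_add' x y := by simp [add_smul]; abel
  map_smul' r x := by simp [mul_smul]

theorem pl_apply (b : OrthonormalBasis (Fin 3) ℝ (EuclideanSpace ℝ (Fin 3))) (w) :
    pl b w = w 0 • b 1 + w 1 • b 2 := rfl

theorem pl_isometry (b : OrthonormalBasis (Fin 3) ℝ (EuclideanSpace ℝ (Fin 3))) :
    Isometry (pl b) := by
  apply AddMonoidHomClass.isometry_of_norm
  intro w
  have h : ‖pl b w‖ ^ 2 = ‖w‖ ^ 2 := by
    rw [pl_apply, ← real_inner_self_eq_norm_sq, EuclideanSpace.norm_sq_eq]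
    simp only [inner_add_left, inner_add_right, real_inner_smul_left, real_inner_smul_right,
      b.inner_eq_ite]
    simp [Fin.sum_univ_two]; ring
  exact (pow_left_inj₀ (norm_nonneg _) (norm_nonneg _) two_ne_zero).1 h

theorem exists_onb (n : EuclideanSpace ℝ (Fin 3)) (hn : ‖n‖ = 1) :
    ∃ b : OrthonormalBasis (Fin 3) ℝ (EuclideanSpace ℝ (Fin 3)), b 0 = n := by
  have h : Orthonormal ℝ (Set.domRestrict {(0 : Fin 3)} (fun _ => n)) := by
    constructor
    · intro i; exact hn
    · intro i j hij
      exact absurd (Subsingleton.elim i j) hij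
  obtain ⟨b, hb⟩ := Orthonormal.exists_orthonormalBasis_extension_of_card_eq
    (𝕜 := ℝ) (by simp) h
  exact ⟨b, hb 0 rfl⟩

theorem pl_repr (b : OrthonormalBasis (Fin 3) ℝ (EuclideanSpace ℝ (Fin 3))) (x)
    (hx : ⟪x, b 0⟫ = 0) : pl b (!₂[⟪b 1, x⟫, ⟪b 2, x⟫]) = x := by
  conv_rhs => rw [← b.sum_repr x]
  rw [real_inner_comm] at hx
  simp [pl_apply, Fin.sum_univ_three, b.repr_apply_apply, hx]

/-- orthogonal projection to the plane perpendicular to `e`. -/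
noncomputable def pr (e : EuclideanSpace ℝ (Fin 3)) (x : EuclideanSpace ℝ (Fin 3)) :
    EuclideanSpace ℝ (Fin 3) := x - ⟪x, e⟫ • e

noncomputable def mm (b c : OrthonormalBasis (Fin 3) ℝ (EuclideanSpace ℝ (Fin 3))) :
    Matrix (Fin 2) (Fin 2) ℝ := !![⟪c 1, b 1⟫, ⟪c 1, b 2⟫; ⟪c 2, b 1⟫, ⟪c 2, b 2⟫]

theorem mm_det (b c : OrthonormalBasis (Fin 3) ℝ (EuclideanSpace ℝ (Fin 3))) :
    |(mm b c).det| = |⟪b 0, c 0⟫| := by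
  let R : Matrix (Fin 3) (Fin 3) ℝ := Matrix.of fun i j => ⟪c i, b j⟫
  have hR : R * R.transpose = 1 := by
    ext i j
    simp only [R, Matrix.mul_apply, Matrix.transpose_apply, Matrix.of_apply]
    have := b.sum_inner_mul_inner (c i) (c j)
    simp only [real_inner_comm (c j)] at this
    rw [this, c.inner_eq_ite, Matrix.one_apply]; simp [eq_comm]
  have hd : R.det * R.det = 1 := by
    have := congrArg Matrix.det hR
    simpa using this
  have had : R.adjugate = R.det • R.transpose := by
    calc R.adjugate = R.adjugate * (R * R.transpose) := by rw [hR, mul_one]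
      _ = R.det • R.transpose := by
        rw [← mul_assoc, Matrix.adjugate_mul, Matrix.smul_mul, one_mul]
  have h0 := congrFun (congrFun had 0) 0
  rw [Matrix.adjugate_fin_three] at h0
  simp [R] at h0
  have h1 : |R.det| = 1 := by
    have : |R.det| * |R.det| = 1 := by rw [← abs_mul, hd, abs_one]
    nlinarith [abs_nonneg R.det]
  rw [mm, Matrix.det_fin_two_of, real_inner_comm (c 0), h0, abs_mul]
  change |R.det| * _ = _
  rw [h1, one_mul]

instance haar2 : Measure.IsAddHaarMeasure (μH[2] : Measure (EuclideanSpace ℝ (Fin 2))) := by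
  have := isAddHaarMeasure_hausdorffMeasure (E := EuclideanSpace ℝ (Fin 2))
  simpa using this

theorem image_plane (n e : EuclideanSpace ℝ (Fin 3)) (hn : ‖n‖ = 1) (he : ‖e‖ = 1)
    (B : Set (EuclideanSpace ℝ (Fin 3))) (hB : ∀ x ∈ B, ⟪x, n⟫ = 0) :
    μH[2] (pr e '' B) = ENNReal.ofReal |⟪n, e⟫| * μH[2] B := by
  obtain ⟨b, rfl⟩ := exists_onb n hn
  obtain ⟨c, rfl⟩ := exists_onb e he
  set B' := pl b ⁻¹' B with hB'
  have h1 : pl b '' B' = B := by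
    rw [Set.image_preimage_eq_inter_range, Set.inter_eq_left]
    intro x hx
    exact ⟨_, pl_repr b x (hB x hx)⟩
  let M := Matrix.toEuclideanLin (mm b c)
  have h2 : ∀ w, pr (c 0) (pl b w) = pl c (M w) := by
    intro w
    have hp : ⟪pr (c 0) (pl b w), c 0⟫ = 0 := by
      simp [pr, inner_sub_left, real_inner_smul_left]
    rw [← pl_repr c _ hp]
    congr 1
    ext i
    fin_cases i <;>
    simp [M, mm, pr, pl_apply, inner_sub_right, inner_add_right, real_inner_smul_right, c.inner_eq_ite, Matrix.toEuclideanLin, Matrix.toLpLin_apply, dotProduct, Fin.sum_univ_two] <;> ring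
  have h3 : pr (c 0) '' B = pl c '' (M '' B') := by
    rw [← h1, Set.image_image, Set.image_image]
    exact Set.image_congr fun w _ => h2 w
  have hM : LinearMap.det M = (mm b c).det := by
    simp [M]
  rw [h3, (pl_isometry c).hausdorffMeasure_image (Or.inl (by norm_num)),
    Measure.addHaar_image_linearMap, hM, mm_det]
  conv_rhs => rw [← h1, (pl_isometry b).hausdorffMeasure_image (Or.inl (by norm_num))]

theorem pr_continuous (e : EuclideanSpace ℝ (Fin 3)) : Continuous (pr e) := by
  unfold pr; fun_prop

/-- Finite measure of bounded pieces of planes. -/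
theorem plane_finite (n : EuclideanSpace ℝ (Fin 3)) (hn : ‖n‖ = 1)
    (B : Set (EuclideanSpace ℝ (Fin 3))) (hB : ∀ x ∈ B, ⟪x, n⟫ = 0)
    (hb : Bornology.IsBounded B) : μH[2] B < ⊤ := by
  obtain ⟨b, rfl⟩ := exists_onb n hn
  have h1 : pl b '' (pl b ⁻¹' B) = B := by
    rw [Set.image_preimage_eq_inter_range, Set.inter_eq_left]
    intro x hx
    exact ⟨_, pl_repr b x (hB x hx)⟩
  rw [← h1, (pl_isometry b).hausdorffMeasure_image (Or.inl (by norm_num))]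
  exact ((pl_isometry b).antilipschitz.isBounded_preimage hb).measure_lt_top

theorem normal_continuousOn (K : Set (EuclideanSpace ℝ (Fin 3)))
    (nK : EuclideanSpace ℝ (Fin 3) → EuclideanSpace ℝ (Fin 3))
    (hnorm : ∀ z ∈ frontier K, ‖nK z‖ = 1)
    (hsupp : ∀ z ∈ frontier K, ∀ x ∈ K, ⟪x, nK z⟫ ≤ ⟪z, nK z⟫)
    (hsmooth : ∀ z ∈ frontier K,
      ∃! v : EuclideanSpace ℝ (Fin 3), ‖v‖ = 1 ∧ ∀ x ∈ K, ⟪x, v⟫ ≤ ⟪z, v⟫) :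
    ContinuousOn nK (frontier K) := by
  intro z hz
  refine IsCompact.tendsto_nhds_of_unique_mapClusterPt
    (isCompact_sphere (0 : EuclideanSpace ℝ (Fin 3)) 1) ?_ ?_
  · filter_upwards [self_mem_nhdsWithin] with w hw
    simpa using hnorm w hw
  · intro v hv hc
    obtain ⟨U, hU, hUt⟩ := mapClusterPt_iff_ultrafilter.1 hc
    refine (hsmooth z hz).unique ⟨by simpa using hv, ?_⟩ ⟨hnorm z hz, hsupp z hz⟩
    intro x hx
    have hid : Filter.Tendsto (fun w : EuclideanSpace ℝ (Fin 3) => w) U (nhds z) :=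
      hU.trans nhdsWithin_le_nhds
    refine le_of_tendsto_of_tendsto (Filter.Tendsto.inner tendsto_const_nhds hUt)
      (Filter.Tendsto.inner hid hUt) ?_
    filter_upwards [hU self_mem_nhdsWithin] with w hw
    exact hsupp w hw x hx

/-- oblique projection along `e` to the plane perpendicular to `n`. -/
noncomputable def ob (n e : EuclideanSpace ℝ (Fin 3)) (x : EuclideanSpace ℝ (Fin 3)) :
    EuclideanSpace ℝ (Fin 3) := x - (⟪x, n⟫ / ⟪n, e⟫) • e

/-- Local almost-isometry. -/
theorem local_bilip (F : Set (EuclideanSpace ℝ (Fin 3)))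
    (n : EuclideanSpace ℝ (Fin 3) → EuclideanSpace ℝ (Fin 3))
    (hsupp : ∀ z ∈ F, ∀ x ∈ F, ⟪x, n z⟫ ≤ ⟪z, n z⟫)
    (hcont : ContinuousOn n F) (e : EuclideanSpace ℝ (Fin 3)) (he : ‖e‖ = 1)
    (z₀ : EuclideanSpace ℝ (Fin 3)) (hz₀ : z₀ ∈ F) (ha : 0 < ⟪n z₀, e⟫)
    (c : NNReal) (hc : 1 < c) :
    ∃ U : Set (EuclideanSpace ℝ (Fin 3)), IsOpen U ∧ z₀ ∈ U ∧
      (∀ z ∈ U ∩ F, ⟪n z, e⟫ ≤ c * ⟪n z₀, e⟫ ∧ ⟪n z₀, e⟫ ≤ c * ⟪n z, e⟫) ∧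
      ∀ S ⊆ U ∩ F, μH[2] (ob (n z₀) e '' S) ≤ (c : ENNReal) ^ 2 * μH[2] S ∧
        μH[2] S ≤ (c : ENNReal) ^ 2 * μH[2] (ob (n z₀) e '' S) := by
  set a := ⟪n z₀, e⟫ with hadef
  have hc' : (1 : ℝ) < c := by exact_mod_cast hc
  have hc0 : (0 : ℝ) < c := by linarith
  set η : ℝ := 1 - 1 / c with hη
  have hη0 : 0 < η := by
    rw [hη, sub_pos, div_lt_one hc0]; exact hc'
  have hη1 : 1 - η = 1 / c := by rw [hη]; ring
  have hη2 : 1 + η ≤ c := by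
    rw [hη]
    have : 0 ≤ (c - 1 : ℝ) ^ 2 / c := by positivity
    have h2 : (c - 1 : ℝ) ^ 2 / c = c - 2 + 1 / c := by field_simp; ring
    linarith
  have hev : ∀ᶠ z in nhdsWithin z₀ F, dist (n z) (n z₀) < a * η :=
    Metric.tendsto_nhds.1 (hcont z₀ hz₀) _ (mul_pos ha hη0)
  rw [eventually_nhdsWithin_iff, eventually_nhds_iff] at hev
  obtain ⟨U, hU, hUo, hzU⟩ := hev
  have hd : ∀ z ∈ U ∩ F, ‖n z₀ - n z‖ ≤ a * η := by
    intro z hz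
    have := hU z hz.1 hz.2
    rw [dist_comm, dist_eq_norm] at this
    exact this.le
  have key : ∀ z ∈ U ∩ F, ∀ w ∈ U ∩ F, ⟪w - z, n z₀⟫ ≤ a * η * ‖w - z‖ := by
    intro z hz w hw
    have h1 := hsupp z hz.2 w hw.2
    have h2 : ⟪w - z, n z₀ - n z⟫ ≤ ‖w - z‖ * ‖n z₀ - n z‖ := real_inner_le_norm _ _
    have h3 := mul_le_mul_of_nonneg_left (hd z hz) (norm_nonneg (w - z))
    rw [inner_sub_right, inner_sub_left w z (n z)] at h2
    linarith
  have key2 : ∀ z ∈ U ∩ F, ∀ w ∈ U ∩ F, |⟪w - z, n z₀⟫ / a| ≤ η * ‖w - z‖ := by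
    intro z hz w hw
    rw [abs_div, abs_of_pos ha, div_le_iff₀ ha]
    have h1 := key z hz w hw
    have h2 := key w hw z hz
    rw [← neg_sub w z, inner_neg_left, norm_neg] at h2
    rw [abs_le]
    constructor <;> linarith
  have key3 : ∀ z w, ob (n z₀) e w - ob (n z₀) e z = (w - z) - (⟪w - z, n z₀⟫ / a) • e := by
    intro z w
    simp only [ob, inner_sub_left, sub_div, sub_smul, ← hadef]; abel
  have key4 : ∀ z w, ‖(⟪w - z, n z₀⟫ / a) • e‖ = |⟪w - z, n z₀⟫ / a| := by
    intro z w; rw [norm_smul, he, mul_one, Real.norm_eq_abs]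
  refine ⟨U, hUo, hzU, ?_, ?_⟩
  · intro z hz
    have h1 : |⟪n z₀ - n z, e⟫| ≤ a * η := by
      have := abs_real_inner_le_norm (n z₀ - n z) e
      rw [he, mul_one] at this
      exact this.trans (hd z hz)
    rw [inner_sub_left, ← hadef, abs_le] at h1
    constructor
    · have : a * (1 + η) ≤ a * c := mul_le_mul_of_nonneg_left hη2 ha.le
      linarith
    · have : a * (1 / c) ≤ ⟪n z, e⟫ := by rw [← hη1]; linarith
      rw [mul_one_div, div_le_iff₀ hc0] at this
      linarith
  · intro S hS
    have hl : LipschitzOnWith c (ob (n z₀) e) S := by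
      apply LipschitzOnWith.of_dist_le_mul
      intro w hw z hz
      rw [dist_eq_norm, dist_eq_norm, key3]
      have h1 := norm_sub_le (w - z) ((⟪w - z, n z₀⟫ / a) • e)
      rw [key4] at h1
      have h2 := key2 z (hS hz) w (hS hw)
      have h3 := mul_le_mul_of_nonneg_right hη2 (norm_nonneg (w - z))
      linarith
    have hal : ∀ w ∈ S, ∀ z ∈ S, dist w z ≤ c * dist (ob (n z₀) e w) (ob (n z₀) e z) := by
      intro w hw z hz
      rw [dist_eq_norm, dist_eq_norm, key3]
      have h1 := norm_sub_norm_le (w - z) ((⟪w - z, n z₀⟫ / a) • e)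
      rw [key4] at h1
      have h2 := key2 z (hS hz) w (hS hw)
      have h3 : (1 / c) * ‖w - z‖ ≤ ‖w - z - (⟪w - z, n z₀⟫ / a) • e‖ := by
        rw [← hη1]; linarith
      rw [one_div, inv_mul_le_iff₀ hc0] at h3
      exact h3
    constructor
    · have := hl.hausdorffMeasure_image_le (d := 2) (by norm_num)
      simpa using this
    · have hinj : Set.InjOn (ob (n z₀) e) S := by
        intro w hw z hz hwz
        have := hal w hw z hz
        rw [hwz, dist_self, mul_zero] at this
        exact dist_le_zero.1 this
      have hl2 : LipschitzOnWith c (Function.invFunOn (ob (n z₀) e) S) (ob (n z₀) e '' S) := by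
        apply LipschitzOnWith.of_dist_le_mul
        rintro _ ⟨w, hw, rfl⟩ _ ⟨z, hz, rfl⟩
        rw [hinj.leftInvOn_invFunOn hw, hinj.leftInvOn_invFunOn hz]
        exact hal w hw z hz
      have := hl2.hausdorffMeasure_image_le (d := 2) (by norm_num)
      rw [hinj.leftInvOn_invFunOn.image_image] at this
      simpa using this

theorem ob_perp (n e x : EuclideanSpace ℝ (Fin 3)) (h : ⟪n, e⟫ ≠ 0) : ⟪ob n e x, n⟫ = 0 := by
  rw [ob, inner_sub_left, real_inner_smul_left, real_inner_comm n e, div_mul_cancel₀ _ h, sub_self]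

theorem pr_ob (n e x : EuclideanSpace ℝ (Fin 3)) (he : ‖e‖ = 1) : pr e (ob n e x) = pr e x := by
  have : ⟪e, e⟫ = 1 := by rw [real_inner_self_eq_norm_sq, he]; norm_num
  simp only [pr, ob, inner_sub_left, real_inner_smul_left, this, sub_smul, mul_one]
  abel

theorem pr_ob_image (n e : EuclideanSpace ℝ (Fin 3)) (hn : ‖n‖ = 1) (he : ‖e‖ = 1)
    (h : 0 < ⟪n, e⟫) (S : Set (EuclideanSpace ℝ (Fin 3))) :
    μH[2] (pr e '' S) = ENNReal.ofReal ⟪n, e⟫ * μH[2] (ob n e '' S) := by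
  have := image_plane n e hn he (ob n e '' S) (by
    rintro _ ⟨x, _, rfl⟩; exact ob_perp n e x h.ne')
  rw [abs_of_pos h] at this
  rw [← this, Set.image_image]
  simp only [pr_ob n e _ he]

theorem frontier_finite (F : Set (EuclideanSpace ℝ (Fin 3))) (hF : IsCompact F)
    (n : EuclideanSpace ℝ (Fin 3) → EuclideanSpace ℝ (Fin 3))
    (hnorm : ∀ z ∈ F, ‖n z‖ = 1)
    (hsupp : ∀ z ∈ F, ∀ x ∈ F, ⟪x, n z⟫ ≤ ⟪z, n z⟫)
    (hcont : ContinuousOn n F) : μH[2] F < ⊤ := by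
  apply hF.measure_lt_top_of_nhdsWithin
  intro z hz
  have h1 : ⟪n z, n z⟫ = 1 := by rw [real_inner_self_eq_norm_sq, hnorm z hz]; norm_num
  obtain ⟨U, hUo, hzU, -, hU⟩ := local_bilip F n hsupp hcont (n z) (hnorm z hz) z hz
    (by rw [h1]; norm_num) 2 (by norm_num)
  refine ⟨U ∩ F, ?_, ?_⟩
  · exact Filter.inter_mem (mem_nhdsWithin_of_mem_nhds (hUo.mem_nhds hzU)) self_mem_nhdsWithin
  · refine (hU _ subset_rfl).2.trans_lt ?_
    apply ENNReal.mul_lt_top (by simp)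
    apply plane_finite (n z) (hnorm z hz)
    · rintro _ ⟨x, _, rfl⟩; exact ob_perp _ _ x (by rw [h1]; norm_num)
    · have hcb : Continuous (ob (n z) (n z)) := by unfold ob; fun_prop
      exact (hF.image hcb).isBounded.subset (Set.image_mono Set.inter_subset_right)

theorem local_area (F : Set (EuclideanSpace ℝ (Fin 3)))
    (n : EuclideanSpace ℝ (Fin 3) → EuclideanSpace ℝ (Fin 3))
    (hnorm : ∀ z ∈ F, ‖n z‖ = 1)
    (hsupp : ∀ z ∈ F, ∀ x ∈ F, ⟪x, n z⟫ ≤ ⟪z, n z⟫)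
    (hcont : ContinuousOn n F) (e : EuclideanSpace ℝ (Fin 3)) (he : ‖e‖ = 1)
    (z₀ : EuclideanSpace ℝ (Fin 3)) (hz₀ : z₀ ∈ F) (ha : 0 < ⟪n z₀, e⟫)
    (c : NNReal) (hc : 1 < c) :
    ∃ U : Set (EuclideanSpace ℝ (Fin 3)), IsOpen U ∧ z₀ ∈ U ∧
      ∀ S ⊆ U ∩ F, MeasurableSet S →
        μH[2] (pr e '' S) ≤ (c : ENNReal) ^ 3 * ∫⁻ z in S, ENNReal.ofReal ⟪n z, e⟫ ∂μH[2] ∧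
        ∫⁻ z in S, ENNReal.ofReal ⟪n z, e⟫ ∂μH[2] ≤ (c : ENNReal) ^ 3 * μH[2] (pr e '' S) := by
  obtain ⟨U, hUo, hzU, h1, h2⟩ := local_bilip F n hsupp hcont e he z₀ hz₀ ha c hc
  refine ⟨U, hUo, hzU, fun S hS hSm => ?_⟩
  obtain ⟨h3, h4⟩ := h2 S hS
  have hcof : (c : ENNReal) = ENNReal.ofReal c := by simp
  rw [pr_ob_image (n z₀) e (hnorm _ hz₀) he ha]
  constructor
  · have h5 : ENNReal.ofReal ⟪n z₀, e⟫ * μH[2] S ≤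
        c * ∫⁻ z in S, ENNReal.ofReal ⟪n z, e⟫ ∂μH[2] := by
      rw [← lintegral_const_mul' _ _ (by simp), ← setLIntegral_const]
      apply setLIntegral_mono' hSm
      intro z hz
      rw [hcof, ← ENNReal.ofReal_mul (by positivity)]
      exact ENNReal.ofReal_le_ofReal (h1 z (hS hz)).2
    calc _ ≤ ENNReal.ofReal ⟪n z₀, e⟫ * ((c : ENNReal) ^ 2 * μH[2] S) := by gcongr
      _ = (c : ENNReal) ^ 2 * (ENNReal.ofReal ⟪n z₀, e⟫ * μH[2] S) := by ring
      _ ≤ (c : ENNReal) ^ 2 * (c * ∫⁻ z in S, ENNReal.ofReal ⟪n z, e⟫ ∂μH[2]) := by gcongr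
      _ = _ := by ring
  · have h5 : ∫⁻ z in S, ENNReal.ofReal ⟪n z, e⟫ ∂μH[2] ≤
        c * (ENNReal.ofReal ⟪n z₀, e⟫ * μH[2] S) := by
      rw [← mul_assoc, ← setLIntegral_const]
      apply setLIntegral_mono' hSm
      intro z hz
      rw [hcof, ← ENNReal.ofReal_mul (by positivity)]
      exact ENNReal.ofReal_le_ofReal (h1 z (hS hz)).1
    calc _ ≤ _ := h5
      _ ≤ c * (ENNReal.ofReal ⟪n z₀, e⟫ * ((c : ENNReal) ^ 2 * μH[2] (ob (n z₀) e '' S))) := by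
        gcongr
      _ = _ := by ring

theorem pr_injOn (F : Set (EuclideanSpace ℝ (Fin 3)))
    (n : EuclideanSpace ℝ (Fin 3) → EuclideanSpace ℝ (Fin 3))
    (hsupp : ∀ z ∈ F, ∀ x ∈ F, ⟪x, n z⟫ ≤ ⟪z, n z⟫)
    (e : EuclideanSpace ℝ (Fin 3)) (S : Set (EuclideanSpace ℝ (Fin 3))) (hS : S ⊆ F)
    (hpos : ∀ z ∈ S, 0 < ⟪n z, e⟫) : Set.InjOn (pr e) S := by
  intro x hx y hy hxy
  have h1 : x - y = (⟪x, e⟫ - ⟪y, e⟫) • e := by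
    simp only [pr] at hxy
    rw [sub_smul, sub_eq_sub_iff_add_eq_add]
    rw [sub_eq_sub_iff_add_eq_add] at hxy
    rw [hxy]; abel
  have h2 : ∀ v, ⟪x, v⟫ - ⟪y, v⟫ = (⟪x, e⟫ - ⟪y, e⟫) * ⟪v, e⟫ := by
    intro v
    rw [← inner_sub_left, h1, real_inner_smul_left, real_inner_comm v e]
  have h3 := h2 (n x)
  have h4 := h2 (n y)
  have h5 := hsupp x (hS hx) y (hS hy)
  have h6 := hsupp y (hS hy) x (hS hx)
  have h7 := hpos x hx
  have h8 := hpos y hy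
  have h9 : ⟪x, e⟫ - ⟪y, e⟫ = 0 := by
    apply le_antisymm
    · by_contra h; push Not at h; nlinarith [mul_pos h h8]
    · by_contra h; push Not at h; nlinarith [mul_pos (neg_pos.2 h) h7]
  rw [h9, zero_smul, sub_eq_zero] at h1
  exact h1

theorem le_of_forall_c (A B : ENNReal) (h : ∀ c : NNReal, 1 < c → A ≤ (c : ENNReal) ^ 3 * B) :
    A ≤ B := by
  have ht : Filter.Tendsto (fun c : NNReal => (c : ENNReal) ^ 3 * B) (nhdsWithin 1 (Set.Ioi 1))
      (nhds (((1 : NNReal) : ENNReal) ^ 3 * B)) := by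
    apply ENNReal.Tendsto.mul_const
    · apply Filter.Tendsto.mono_left _ nhdsWithin_le_nhds
      exact ((ENNReal.continuous_pow 3).comp ENNReal.continuous_coe).tendsto 1
    · left; simp
  have := ge_of_tendsto ht (by
    filter_upwards [self_mem_nhdsWithin] with c hc using h c hc)
  simpa using this

theorem area (F : Set (EuclideanSpace ℝ (Fin 3)))
    (n : EuclideanSpace ℝ (Fin 3) → EuclideanSpace ℝ (Fin 3))
    (hnorm : ∀ z ∈ F, ‖n z‖ = 1)
    (hsupp : ∀ z ∈ F, ∀ x ∈ F, ⟪x, n z⟫ ≤ ⟪z, n z⟫)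
    (hcont : ContinuousOn n F) (e : EuclideanSpace ℝ (Fin 3)) (he : ‖e‖ = 1)
    (S : Set (EuclideanSpace ℝ (Fin 3))) (hS : S ⊆ F) (hSm : MeasurableSet S)
    (hpos : ∀ z ∈ S, 0 < ⟪n z, e⟫) :
    ∫⁻ z in S, ENNReal.ofReal ⟪n z, e⟫ ∂μH[2] = μH[2] (pr e '' S) := by
  have main : ∀ c : NNReal, 1 < c →
      μH[2] (pr e '' S) ≤ (c : ENNReal) ^ 3 * ∫⁻ z in S, ENNReal.ofReal ⟪n z, e⟫ ∂μH[2] ∧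
      ∫⁻ z in S, ENNReal.ofReal ⟪n z, e⟫ ∂μH[2] ≤ (c : ENNReal) ^ 3 * μH[2] (pr e '' S) := by
    intro c hc
    have hex : ∀ z : S, _ := fun z => local_area F n hnorm hsupp hcont e he z (hS z.2)
      (hpos z z.2) c hc
    choose U hUo hzU hU using hex
    rcases S.eq_empty_or_nonempty with hSe | hSne
    · simp [hSe]
    obtain ⟨T, hTc, hT⟩ := TopologicalSpace.isOpen_iUnion_countable U hUo
    have hcov : S ⊆ ⋃ i ∈ T, U i := by
      rw [hT]; intro z hz; exact Set.mem_iUnion.2 ⟨⟨z, hz⟩, hzU _⟩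
    have hTne : T.Nonempty := by
      obtain ⟨z, hz⟩ := hSne
      obtain ⟨i, hi, -⟩ := Set.mem_iUnion₂.1 (hcov hz)
      exact ⟨i, hi⟩
    obtain ⟨f, rfl⟩ := hTc.exists_eq_range hTne
    let V : ℕ → Set (EuclideanSpace ℝ (Fin 3)) := fun k => S ∩ disjointed (fun k => U (f k)) k
    have hVm : ∀ k, MeasurableSet (V k) := fun k =>
      hSm.inter (MeasurableSet.disjointed (fun k => (hUo _).measurableSet) k)
    have hVd : Pairwise (Function.onFun Disjoint V) := fun i j hij =>
      (disjoint_disjointed _ hij).mono Set.inter_subset_right Set.inter_subset_right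
    have hVu : S = ⋃ k, V k := by
      rw [← Set.inter_iUnion, iUnion_disjointed, Set.left_eq_inter]
      simpa using hcov
    have hVS : ∀ k, V k ⊆ S := fun k => Set.inter_subset_left
    have hVU : ∀ k, V k ⊆ U (f k) ∩ F := fun k x hx =>
      ⟨disjointed_subset (fun k => U (f k)) k hx.2, hS hx.1⟩
    have hinj := pr_injOn F n hsupp e S hS hpos
    have e1 : ∫⁻ z in S, ENNReal.ofReal ⟪n z, e⟫ ∂μH[2] =
        ∑' k, ∫⁻ z in V k, ENNReal.ofReal ⟪n z, e⟫ ∂μH[2] := by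
      conv_lhs => rw [hVu]
      rw [lintegral_iUnion hVm hVd]
    have e2 : μH[2] (pr e '' S) = ∑' k, μH[2] (pr e '' V k) := by
      conv_lhs => rw [hVu, Set.image_iUnion]
      rw [measure_iUnion]
      · intro i j hij
        exact (Set.disjoint_image_image fun x hx y hy hxy =>
          Set.disjoint_left.1 (hVd hij) hx (hinj (hVS i hx) (hVS j hy) hxy ▸ hy))
      · intro k
        exact (hVm k).image_of_continuousOn_injOn (pr_continuous e).continuousOn
          (hinj.mono (hVS k))
    rw [e1, e2, ← ENNReal.tsum_mul_left, ← ENNReal.tsum_mul_left]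
    exact ⟨ENNReal.tsum_le_tsum fun k => (hU (f k) (V k) (hVU k) (hVm k)).1,
      ENNReal.tsum_le_tsum fun k => (hU (f k) (V k) (hVU k) (hVm k)).2⟩
  exact le_antisymm (le_of_forall_c _ _ fun c hc => (main c hc).2)
    (le_of_forall_c _ _ fun c hc => (main c hc).1)

theorem section_frontier_null (K : Set (EuclideanSpace ℝ (Fin 3))) (hKconv : Convex ℝ K)
    (h0 : (0 : EuclideanSpace ℝ (Fin 3)) ∈ interior K) (e : EuclideanSpace ℝ (Fin 3))
    (he : ‖e‖ = 1) : μH[2] (frontier K ∩ {x | ⟪x, e⟫ = 0}) = 0 := by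
  obtain ⟨b, rfl⟩ := exists_onb e he
  have hconv : Convex ℝ (pl b ⁻¹' K) := hKconv.linear_preimage (pl b)
  have hnull := hconv.addHaar_frontier (μ := (μH[2] : Measure (EuclideanSpace ℝ (Fin 2))))
  rw [← (pl_isometry b).hausdorffMeasure_image (Or.inl (by norm_num))] at hnull
  refine measure_mono_null ?_ hnull
  rintro x ⟨hx, hxe⟩
  refine ⟨_, ?_, pl_repr b x hxe⟩
  set w : EuclideanSpace ℝ (Fin 2) := !₂[⟪b 1, x⟫, ⟪b 2, x⟫] with hw
  have hwx : pl b w = x := pl_repr b x hxe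
  have hcl : x ∈ closure K := frontier_subset_closure hx
  constructor
  · rw [Metric.mem_closure_iff]
    intro ε hε
    -- scale towards the origin
    have hc : Filter.Tendsto (fun t : ℝ => t • w) (nhdsWithin 1 (Set.Iio 1)) (nhds ((1 : ℝ) • w)) :=
      ((continuous_id.smul continuous_const).tendsto 1).mono_left nhdsWithin_le_nhds
    rw [one_smul] at hc
    have h1 := Metric.tendsto_nhds.1 hc ε hε
    have h2 : ∀ᶠ t : ℝ in nhdsWithin 1 (Set.Iio 1), t ∈ Set.Ioo (0 : ℝ) 1 :=
      Ioo_mem_nhdsLT (by norm_num)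
    obtain ⟨t, ht1, ht2⟩ := (h1.and h2).exists
    refine ⟨t • w, ?_, by rwa [dist_comm]⟩
    rw [Set.mem_preimage, map_smul, hwx]
    have := hKconv.combo_interior_closure_mem_interior h0 hcl (a := 1 - t) (b := t)
      (by linarith [ht2.2]) ht2.1.le (by ring)
    rw [smul_zero, zero_add] at this
    exact interior_subset this
  · intro hIntg
    have hc : Filter.Tendsto (fun t : ℝ => t • w) (nhdsWithin 1 (Set.Ioi 1)) (nhds ((1 : ℝ) • w)) :=
      ((continuous_id.smul continuous_const).tendsto 1).mono_left nhdsWithin_le_nhds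
    rw [one_smul] at hc
    have h1 := hc (mem_interior_iff_mem_nhds.1 hIntg)
    obtain ⟨t, ht1, ht2⟩ := (Filter.Eventually.and (Filter.mem_map.1 h1) self_mem_nhdsWithin).exists
    have ht2 : 1 < t := ht2
    have ht1 : pl b (t • w) ∈ K := ht1
    rw [map_smul, hwx] at ht1
    have hti : t⁻¹ < 1 := inv_lt_one_of_one_lt₀ ht2
    have := hKconv.combo_interior_closure_mem_interior h0 (subset_closure ht1) (a := 1 - t⁻¹)
      (b := t⁻¹) (by linarith) (by positivity) (by ring)
    rw [smul_zero, zero_add, smul_smul, inv_mul_cancel₀ (by linarith), one_smul] at this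
    exact hx.2 this

theorem inner_lt_of_interior (K : Set (EuclideanSpace ℝ (Fin 3)))
    (z v y : EuclideanSpace ℝ (Fin 3)) (hv : ‖v‖ = 1)
    (hs : ∀ x ∈ K, ⟪x, v⟫ ≤ ⟪z, v⟫) (hy : y ∈ interior K) : ⟪y, v⟫ < ⟪z, v⟫ := by
  have hc : Filter.Tendsto (fun t : ℝ => y + t • v) (nhdsWithin 0 (Set.Ioi 0))
      (nhds (y + (0 : ℝ) • v)) :=
    ((continuous_const.add (continuous_id.smul continuous_const)).tendsto 0).mono_left
      nhdsWithin_le_nhds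
  rw [zero_smul, add_zero] at hc
  obtain ⟨t, ht1, ht2⟩ := (Filter.Eventually.and (Filter.mem_map.1 (hc (mem_interior_iff_mem_nhds.1 hy)))
    self_mem_nhdsWithin).exists
  have ht2 : 0 < t := ht2
  have h := hs _ ht1
  rw [inner_add_left, real_inner_smul_left, real_inner_self_eq_norm_sq, hv] at h
  linarith

theorem exit_point (K : Set (EuclideanSpace ℝ (Fin 3))) (hK : IsCompact K)
    (e : EuclideanSpace ℝ (Fin 3)) (he : ‖e‖ = 1) (y : EuclideanSpace ℝ (Fin 3))
    (hy : y ∈ interior K) : ∃ t : ℝ, 0 < t ∧ y + t • e ∈ frontier K := by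
  let g : ℝ → EuclideanSpace ℝ (Fin 3) := fun t => y + t • e
  have hg : Continuous g := by fun_prop
  have hpre : IsPreconnected (g '' Set.Ici 0) := isPreconnected_Ici.image g hg.continuousOn
  obtain ⟨R, hR⟩ := hK.isBounded.exists_norm_le
  have h2 : (g '' Set.Ici 0 ∩ Kᶜ).Nonempty := by
    refine ⟨g (|R| + ‖y‖ + 1), ⟨_, by simp only [Set.mem_Ici]; positivity, rfl⟩, fun hk => ?_⟩
    have h3 := hR _ hk
    have h4 : ‖(|R| + ‖y‖ + 1) • e‖ ≤ ‖g (|R| + ‖y‖ + 1)‖ + ‖y‖ := by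
      have : (|R| + ‖y‖ + 1) • e = g (|R| + ‖y‖ + 1) - y := by simp [g]
      rw [this]; exact norm_sub_le _ _
    rw [norm_smul, he, mul_one, Real.norm_of_nonneg (by positivity)] at h4
    linarith [le_abs_self R]
  have hex : ∃ t ∈ Set.Ici (0 : ℝ), g t ∈ frontier K := by
    by_contra hcon
    push Not at hcon
    obtain ⟨x, -, hx1, hx2⟩ := hpre (interior K) Kᶜ isOpen_interior hK.isClosed.isOpen_compl
      (by
        rintro _ ⟨t, ht, rfl⟩
        by_cases hk : g t ∈ K
        · left
          by_contra hi
          exact hcon t ht ⟨subset_closure hk, hi⟩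
        · right; exact hk)
      ⟨y, ⟨0, by simp, by simp [g]⟩, hy⟩ h2
    exact hx2 (interior_subset hx1)
  obtain ⟨t, ht, hf⟩ := hex
  refine ⟨t, lt_of_le_of_ne ht ?_, hf⟩
  rintro rfl
  simp only [g, zero_smul, add_zero] at hf
  exact hf.2 hy

theorem line_interior (K : Set (EuclideanSpace ℝ (Fin 3)))
    (hKconv : Convex ℝ K)
    (hKint : (interior K).Nonempty)
    (nK : EuclideanSpace ℝ (Fin 3) → EuclideanSpace ℝ (Fin 3))
    (hnorm : ∀ z ∈ frontier K, ‖nK z‖ = 1)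
    (hsupp : ∀ z ∈ frontier K, ∀ x ∈ K, ⟪x, nK z⟫ ≤ ⟪z, nK z⟫)
    (hsmooth : ∀ z ∈ frontier K,
      ∃! v : EuclideanSpace ℝ (Fin 3), ‖v‖ = 1 ∧ ∀ x ∈ K, ⟪x, v⟫ ≤ ⟪z, v⟫)
    (e z : EuclideanSpace ℝ (Fin 3)) (hz : z ∈ frontier K) (hne : ⟪nK z, e⟫ ≠ 0) :
    ∃ t : ℝ, z + t • e ∈ interior K := by
  by_contra hcon
  push Not at hcon
  let L : Set (EuclideanSpace ℝ (Fin 3)) := Set.range fun t : ℝ => z + t • e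
  have hL : Convex ℝ L := by
    rintro _ ⟨s, rfl⟩ _ ⟨t, rfl⟩ a b ha hb hab
    refine ⟨a * s + b * t, ?_⟩
    have : z = a • z + b • z := by rw [← add_smul, hab, one_smul]
    dsimp only
    conv_lhs => rw [this]
    module
  have hd : Disjoint (interior K) L := by
    rw [Set.disjoint_right]
    rintro _ ⟨t, rfl⟩
    exact hcon t
  obtain ⟨f, u, hf1, hf2⟩ := geometric_hahn_banach_open hKconv.interior isOpen_interior hL hd
  have hfe : f e = 0 := by
    by_contra hfe
    have := hf2 _ ⟨(u - 1 - f z) / f e, rfl⟩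
    simp only [map_add, map_smul, smul_eq_mul] at this
    rw [div_mul_cancel₀ _ hfe] at this
    linarith
  have hfz : u ≤ f z := hf2 z ⟨0, by simp⟩
  have hfK : ∀ x ∈ K, f x ≤ u := by
    intro x hx
    have hx' : x ∈ closure (interior K) := by
      rw [hKconv.closure_interior_eq_closure_of_nonempty_interior hKint]
      exact subset_closure hx
    exact closure_minimal (fun y hy => (hf1 y hy).le)
      (isClosed_le f.continuous continuous_const) hx'
  let v := (InnerProductSpace.toDual ℝ (EuclideanSpace ℝ (Fin 3))).symm f
  have hv : ∀ x, ⟪x, v⟫ = f x := by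
    intro x; rw [real_inner_comm]; exact InnerProductSpace.toDual_symm_apply
  have hv0 : v ≠ 0 := by
    intro h0
    obtain ⟨y, hy⟩ := hKint
    have h1 := hf1 y hy
    have h2 := hv y
    have h3 := hv z
    rw [h0, inner_zero_right] at h2 h3
    linarith
  have hvn : 0 < ‖v‖ := norm_pos_iff.2 hv0
  have heq : nK z = ‖v‖⁻¹ • v := by
    refine (hsmooth z hz).unique ⟨hnorm z hz, hsupp z hz⟩ ⟨?_, ?_⟩
    · rw [norm_smul, norm_inv, norm_norm, inv_mul_cancel₀ hvn.ne']
    · intro x hx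
      rw [real_inner_smul_right, real_inner_smul_right, hv, hv]
      exact mul_le_mul_of_nonneg_left ((hfK x hx).trans hfz) (by positivity)
  apply hne
  rw [heq, real_inner_smul_left, real_inner_comm, hv, hfe, mul_zero]

theorem pr_add (e x : EuclideanSpace ℝ (Fin 3)) (he : ‖e‖ = 1) (t : ℝ) :
    pr e (x + t • e) = pr e x := by
  have : ⟪e, e⟫ = 1 := by rw [real_inner_self_eq_norm_sq, he]; norm_num
  simp only [pr, inner_add_left, real_inner_smul_left, this, mul_one, add_smul]
  abel

theorem pr_eq (e x : EuclideanSpace ℝ (Fin 3)) (hx : ⟪x, e⟫ = 0) : pr e x = x := by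
  simp [pr, hx]

theorem pr_perp (e x : EuclideanSpace ℝ (Fin 3)) (he : ‖e‖ = 1) : ⟪pr e x, e⟫ = 0 := by
  have : ⟪e, e⟫ = 1 := by rw [real_inner_self_eq_norm_sq, he]; norm_num
  rw [pr, inner_sub_left, real_inner_smul_left, this, mul_one, sub_self]

theorem direction (K : Set (EuclideanSpace ℝ (Fin 3)))
    (hKcomp : IsCompact K) (hKconv : Convex ℝ K)
    (h0 : (0 : EuclideanSpace ℝ (Fin 3)) ∈ interior K)
    (nK : EuclideanSpace ℝ (Fin 3) → EuclideanSpace ℝ (Fin 3))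
    (hnorm : ∀ z ∈ frontier K, ‖nK z‖ = 1)
    (hsupp : ∀ z ∈ frontier K, ∀ x ∈ K, ⟪x, nK z⟫ ≤ ⟪z, nK z⟫)
    (hsmooth : ∀ z ∈ frontier K,
      ∃! v : EuclideanSpace ℝ (Fin 3), ‖v‖ = 1 ∧ ∀ x ∈ K, ⟪x, v⟫ ≤ ⟪z, v⟫)
    (e : EuclideanSpace ℝ (Fin 3)) (he : ‖e‖ = 1)
    (Q : Set (EuclideanSpace ℝ (Fin 3))) (hQc : IsClosed Q)
    (hQ : ∀ x ∈ Q, ∀ t : ℝ, x + t • e ∈ Q) :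
    IntegrableOn nK (frontier K ∩ Q ∩ {x | 0 ≤ ⟪x, e⟫}) μH[2] ∧
    ∫ z in frontier K ∩ Q ∩ {x | 0 ≤ ⟪x, e⟫}, ⟪nK z, e⟫ ∂μH[2] =
      (μH[2] (K ∩ {x | ⟪x, e⟫ = 0} ∩ Q)).toReal := by
  have hKcl := hKcomp.isClosed
  have hFK : frontier K ⊆ K := hKcl.frontier_subset
  have hFc : IsCompact (frontier K) := hKcomp.of_isClosed_subset isClosed_frontier hFK
  have hcont := normal_continuousOn K nK hnorm hsupp hsmooth
  have hsuppF : ∀ z ∈ frontier K, ∀ x ∈ frontier K, ⟪x, nK z⟫ ≤ ⟪z, nK z⟫ :=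
    fun z hz x hx => hsupp z hz x (hFK hx)
  have hfin := frontier_finite (frontier K) hFc nK hnorm hsuppF hcont
  have hee : ⟪e, e⟫ = 1 := by rw [real_inner_self_eq_norm_sq, he]; norm_num
  set S := frontier K ∩ Q ∩ {x | 0 ≤ ⟪x, e⟫} with hSdef
  have hSF : S ⊆ frontier K := fun x hx => hx.1.1
  have hSc : IsClosed S := (isClosed_frontier.inter hQc).inter
    (isClosed_le continuous_const (by fun_prop))
  have hSfin : μH[2] S < ⊤ := (measure_mono hSF).trans_lt hfin
  have hIntg : IntegrableOn nK S μH[2] := by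
    have : IsFiniteMeasure ((μH[2] : Measure (EuclideanSpace ℝ (Fin 3))).restrict S) :=
      ⟨by simpa using hSfin⟩
    refine Integrable.of_bound ((hcont.mono hSF).aestronglyMeasurable hSc.measurableSet) 1 ?_
    filter_upwards [ae_restrict_mem hSc.measurableSet] with z hz
    exact (hnorm z (hSF hz)).le
  refine ⟨hIntg, ?_⟩
  have hfc : ContinuousOn (fun z => ⟪nK z, e⟫) S :=
    (hcont.mono hSF).inner continuousOn_const
  have hmeas : ∀ t : Set ℝ, IsOpen t → MeasurableSet (S ∩ (fun z => ⟪nK z, e⟫) ⁻¹' t) := by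
    intro t ht
    obtain ⟨u, hu, hut⟩ := continuousOn_iff'.1 hfc t ht
    rw [Set.inter_comm, hut]
    exact hu.measurableSet.inter hSc.measurableSet
  set Sp := S ∩ (fun z => ⟪nK z, e⟫) ⁻¹' (Set.Ioi 0) with hSp
  set Sm := S ∩ (fun z => ⟪nK z, e⟫) ⁻¹' (Set.Iio 0) with hSm
  have hSpm : MeasurableSet Sp := hmeas _ isOpen_Ioi
  have hSmm : MeasurableSet Sm := hmeas _ isOpen_Iio
  have area1 : ∫⁻ z in S, ENNReal.ofReal ⟪nK z, e⟫ ∂μH[2] = μH[2] (pr e '' Sp) := by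
    rw [← area (frontier K) nK hnorm hsuppF hcont e he Sp (fun x hx => hSF hx.1) hSpm
      (fun z hz => hz.2), ← lintegral_inter_add_sdiff _ S hSpm,
      Set.inter_eq_right.2 (show Sp ⊆ S from Set.inter_subset_left),
      setLIntegral_congr_fun (g := fun _ => 0) (hSc.measurableSet.diff hSpm)]
    · rw [lintegral_zero, add_zero]
    · intro z hz
      apply ENNReal.ofReal_of_nonpos
      by_contra h
      exact hz.2 ⟨hz.1, not_le.1 h⟩
  have area2 : ∫⁻ z in S, ENNReal.ofReal (-⟪nK z, e⟫) ∂μH[2] = μH[2] (pr e '' Sm) := by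
    have hpr : pr e = pr (-e) := by
      funext x; simp [pr]
    rw [hpr, ← area (frontier K) nK hnorm hsuppF hcont (-e) (by rwa [norm_neg]) Sm
      (fun x hx => hSF hx.1) hSmm
      (fun z hz => by
        rw [inner_neg_right]
        exact neg_pos.2 hz.2), ← lintegral_inter_add_sdiff _ S hSmm,
      Set.inter_eq_right.2 (show Sm ⊆ S from Set.inter_subset_left),
      setLIntegral_congr_fun (g := fun _ => 0) (s := S \ Sm) (hSc.measurableSet.diff hSmm)]
    · simp only [inner_neg_right, lintegral_zero, add_zero]
    · intro z hz
      apply ENNReal.ofReal_of_nonpos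
      by_contra h
      exact hz.2 ⟨hz.1, neg_pos.1 (not_le.1 h)⟩
  set D := K ∩ {x | ⟪x, e⟫ = 0} ∩ Q with hD
  set A := frontier K ∩ {x | ⟪x, e⟫ = 0} with hA
  have hAnull : μH[2] A = 0 := section_frontier_null K hKconv h0 e he
  have hDm : MeasurableSet D := ((hKcl.inter
    (isClosed_eq (by fun_prop) continuous_const)).inter hQc).measurableSet
  have hDfin : μH[2] D < ⊤ :=
    plane_finite e he D (fun x hx => hx.1.2) (hKcomp.isBounded.subset fun x hx => hx.1.1)
  have strict : ∀ z ∈ frontier K, ∀ y ∈ interior K, ⟪y, nK z⟫ < ⟪z, nK z⟫ := fun z hz y hy =>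
    inner_lt_of_interior K z (nK z) y (hnorm z hz) (hsupp z hz) hy
  -- sign of the normal seen from an interior point on the vertical line
  have sgn : ∀ y ∈ interior K, ∀ t : ℝ, y + t • e ∈ frontier K → 0 < t * ⟪nK (y + t • e), e⟫ := by
    intro y hy t hz
    have := strict _ hz y hy
    rw [inner_add_left, real_inner_smul_left, real_inner_comm _ e] at this
    linarith
  have sgn2 : ∀ z ∈ frontier K, ∀ t : ℝ, z + t • e ∈ interior K → t * ⟪nK z, e⟫ < 0 := by
    intro z hz t hy
    have := strict _ hz _ hy
    rw [inner_add_left, real_inner_smul_left, real_inner_comm _ e] at this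
    linarith
  have line := line_interior K hKconv ⟨0, h0⟩ nK hnorm hsupp hsmooth e
  have hprQ : ∀ z ∈ Q, pr e z ∈ Q := by
    intro z hz
    have := hQ z hz (-⟪z, e⟫)
    rwa [neg_smul, ← sub_eq_add_neg] at this
  have step1 : D ⊆ pr e '' Sp ∪ A := by
    rintro y ⟨⟨hyK, hye⟩, hyQ⟩
    by_cases hyi : y ∈ interior K
    · left
      obtain ⟨t, ht, hz⟩ := exit_point K hKcomp e he y hyi
      refine ⟨y + t • e, ⟨⟨⟨hz, hQ y hyQ t⟩, ?_⟩, ?_⟩, by rw [pr_add e y he, pr_eq e y hye]⟩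
      · have hye : ⟪y, e⟫ = 0 := hye
        change 0 ≤ ⟪y + t • e, e⟫
        rw [inner_add_left, real_inner_smul_left, hee, hye]; linarith
      · exact (mul_pos_iff_of_pos_left ht).1 (sgn y hyi t hz)
    · right
      exact ⟨⟨subset_closure hyK, hyi⟩, hye⟩
  have step2 : pr e '' Sm ⊆ pr e '' Sp := by
    rintro _ ⟨z, ⟨⟨⟨hzF, hzQ⟩, hze⟩, hzn⟩, rfl⟩
    have hzn : ⟪nK z, e⟫ < 0 := hzn
    have hze : 0 ≤ ⟪z, e⟫ := hze
    obtain ⟨t, ht⟩ := line z hzF hzn.ne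
    have htn := sgn2 z hzF t ht
    have htp : 0 < t := by
      by_contra h; push Not at h; nlinarith [mul_nonneg_of_nonpos_of_nonpos h hzn.le]
    obtain ⟨t', ht', hw⟩ := exit_point K hKcomp e he _ ht
    refine ⟨z + t • e + t' • e, ⟨⟨⟨hw, hQ _ (hQ z hzQ t) t'⟩, ?_⟩, ?_⟩, ?_⟩
    · change 0 ≤ ⟪z + t • e + t' • e, e⟫
      simp only [inner_add_left, real_inner_smul_left, hee]; linarith
    · exact (mul_pos_iff_of_pos_left ht').1 (sgn _ ht t' hw)
    · rw [pr_add e _ he, pr_add e _ he]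
  have step3 : pr e '' Sp ⊆ D ∪ pr e '' Sm := by
    rintro _ ⟨z, ⟨⟨⟨hzF, hzQ⟩, hze⟩, hzn⟩, rfl⟩
    have hzn : 0 < ⟪nK z, e⟫ := hzn
    have hze : 0 ≤ ⟪z, e⟫ := hze
    by_cases hy : pr e z ∈ K
    · left; exact ⟨⟨hy, pr_perp e z he⟩, hprQ z hzQ⟩
    · right
      obtain ⟨t, ht⟩ := line z hzF hzn.ne'
      obtain ⟨t', ht', hw⟩ := exit_point K hKcomp (-e) (by rwa [norm_neg]) _ ht
      rw [smul_neg, ← neg_smul] at hw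
      have hs := sgn _ ht (-t') hw
      have htn := sgn2 z hzF t ht
      have htm : t < 0 := by
        by_contra h; push Not at h; nlinarith [mul_nonneg h hzn.le]
      refine ⟨z + t • e + (-t') • e, ⟨⟨⟨hw, hQ _ (hQ z hzQ t) _⟩, ?_⟩, ?_⟩, ?_⟩
      · change 0 ≤ ⟪z + t • e + (-t') • e, e⟫
        simp only [inner_add_left, real_inner_smul_left, hee]
        by_contra hneg
        push Not at hneg
        apply hy
        have hr : 0 < t' - t := by linarith
        have hmem := hKconv (hFK hzF) (hFK hw) (a := 1 - ⟪z, e⟫ / (t' - t))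
          (b := ⟪z, e⟫ / (t' - t))
          (by rw [sub_nonneg, div_le_one hr]; linarith) (by positivity) (by ring)
        convert hmem using 1
        have hcalc : ⟪z, e⟫ = ⟪z, e⟫ / (t' - t) * (t' - t) := by field_simp
        rw [pr]
        conv_lhs => rw [hcalc]
        module
      · change ⟪nK (z + t • e + (-t') • e), e⟫ < 0
        by_contra h
        push Not at h
        nlinarith [mul_nonneg ht'.le h]
      · rw [pr_add e _ he, pr_add e _ he]
  have step4 : D ∩ pr e '' Sm ⊆ A := by
    rintro _ ⟨⟨⟨hyK, hye⟩, hyQ⟩, ⟨z, ⟨⟨⟨hzF, hzQ⟩, hze⟩, hzn⟩, rfl⟩⟩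
    have hzn : ⟪nK z, e⟫ < 0 := hzn
    have hze : 0 ≤ ⟪z, e⟫ := hze
    have h1 := hsupp z hzF _ hyK
    rw [pr, inner_sub_left, real_inner_smul_left, real_inner_comm _ e] at h1
    have h2 : ⟪z, e⟫ = 0 := by
      apply le_antisymm _ hze
      by_contra h; push Not at h; nlinarith [mul_pos h (neg_pos.2 hzn)]
    rw [pr_eq e z h2]
    exact ⟨hzF, h2⟩
  have hunion : μH[2] (D ∪ pr e '' Sm) = μH[2] D + μH[2] (pr e '' Sm) :=
    measure_union₀' hDm.nullMeasurableSet (measure_mono_null step4 hAnull)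
  have hmain : μH[2] (pr e '' Sp) = μH[2] D + μH[2] (pr e '' Sm) := by
    rw [← hunion]
    apply le_antisymm (measure_mono step3)
    calc μH[2] (D ∪ pr e '' Sm) ≤ μH[2] (pr e '' Sp ∪ A) :=
          measure_mono (Set.union_subset step1 (step2.trans Set.subset_union_left))
      _ ≤ μH[2] (pr e '' Sp) + μH[2] A := measure_union_le _ _
      _ = _ := by rw [hAnull, add_zero]
  have hmfin : μH[2] (pr e '' Sm) < ⊤ :=
    plane_finite e he _ (by rintro _ ⟨x, _, rfl⟩; exact pr_perp e x he)
      ((hFc.image (pr_continuous e)).isBounded.subset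
        (Set.image_mono fun x hx => hSF hx.1))
  rw [integral_eq_lintegral_pos_part_sub_lintegral_neg_part (hIntg.inner_const e), area1, area2,
    hmain, ENNReal.toReal_add hDfin.ne hmfin.ne]
  ring



/-- For a smooth strictly convex symmetric body `K ⊂ ℝ³` equipartitioned by the standard
orthonormal basis, the integral of the outer unit normal over the boundary part in the octant
`ω` equals `(1/4) Σ_i |K ∩ e_i^⊥| ω_i e_i`. -/
theorem normal_integral_over_octant (K : Set (EuclideanSpace ℝ (Fin 3)))
    (hKcomp : IsCompact K) (hKconv : Convex ℝ K) (hKsymm : K = -K)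
    (hKint : (interior K).Nonempty) (hKstrict : StrictConvex ℝ K)
    (nK : EuclideanSpace ℝ (Fin 3) → EuclideanSpace ℝ (Fin 3))
    (hnorm : ∀ z ∈ frontier K, ‖nK z‖ = 1)
    (hsupp : ∀ z ∈ frontier K, ∀ x ∈ K, ⟪x, nK z⟫ ≤ ⟪z, nK z⟫)
    (hsmooth : ∀ z ∈ frontier K,
      ∃! v : EuclideanSpace ℝ (Fin 3), ‖v‖ = 1 ∧ ∀ x ∈ K, ⟪x, v⟫ ≤ ⟪z, v⟫)
    (hoct : ∀ σ : Fin 3 → Bool,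
      volume (K ∩ {x | ∀ i, 0 ≤ (if σ i then (1 : ℝ) else -1) * x i}) = volume K / 8)
    (hsec : ∀ i : Fin 3, ∀ σ : Fin 3 → Bool,
      μH[2] (K ∩ {x | x i = 0} ∩
          {x | ∀ j, j ≠ i → 0 ≤ (if σ j then (1 : ℝ) else -1) * x j}) =
        μH[2] (K ∩ {x | x i = 0}) / 4) :
    ∀ σ : Fin 3 → Bool,
      (∫ z in frontier K ∩ {x | ∀ i, 0 ≤ (if σ i then (1 : ℝ) else -1) * x i},
          nK z ∂μH[2]) =
        (1 / 4 : ℝ) • ∑ i : Fin 3,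
          ((μH[2] (K ∩ {x : EuclideanSpace ℝ (Fin 3) | x i = 0})).toReal *
            (if σ i then (1 : ℝ) else -1)) • EuclideanSpace.single i (1 : ℝ) := by
  intro σ
  have h0 : (0 : EuclideanSpace ℝ (Fin 3)) ∈ interior K := by
    obtain ⟨x, hx⟩ := hKint
    have hnx : -x ∈ interior K := by
      have h1 : -interior K ⊆ interior K := by
        apply interior_maximal _ isOpen_interior.neg
        intro y hy
        rw [hKsymm]
        exact Set.neg_subset_neg.2 interior_subset hy
      exact h1 (by simpa using hx)
    have := hKconv.interior hx hnx (a := 1 / 2) (b := 1 / 2) (by norm_num) (by norm_num)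
      (by norm_num)
    simpa using this
  set S := frontier K ∩ {x : EuclideanSpace ℝ (Fin 3) |
    ∀ i, 0 ≤ (if σ i then (1 : ℝ) else -1) * x i} with hS
  have key : ∀ i : Fin 3, IntegrableOn nK S μH[2] ∧
      ∫ z in S, nK z i ∂μH[2] = (if σ i then (1 : ℝ) else -1) *
        ((μH[2] (K ∩ {x : EuclideanSpace ℝ (Fin 3) | x i = 0})).toReal / 4) := by
    intro i
    set s : Fin 3 → ℝ := fun j => if σ j then (1 : ℝ) else -1 with hs
    have hss : s i * s i = 1 := by
      simp only [hs]; split_ifs <;> norm_num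
    have hs0 : s i ≠ 0 := by intro h; rw [h] at hss; norm_num at hss
    have hin : ∀ x : EuclideanSpace ℝ (Fin 3),
        ⟪x, EuclideanSpace.single i (s i)⟫ = s i * x i := by
      intro x
      simp [EuclideanSpace.inner_single_right]
    have he : ‖EuclideanSpace.single i (s i)‖ = 1 := by
      rw [EuclideanSpace.norm_single]
      simp only [hs]; split_ifs <;> norm_num
    have hQc : IsClosed {x : EuclideanSpace ℝ (Fin 3) | ∀ j, j ≠ i → 0 ≤ s j * x j} := by
      simp only [Set.setOf_forall]
      refine isClosed_iInter fun j => isClosed_iInter fun _ =>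
        isClosed_le continuous_const (by fun_prop)
    obtain ⟨h1, h2⟩ := direction K hKcomp hKconv h0 nK hnorm hsupp hsmooth
      (EuclideanSpace.single i (s i)) he
      {x | ∀ j, j ≠ i → 0 ≤ s j * x j} hQc (by
        intro x hx t j hj
        have := hx j hj
        simpa [hj] using this)
    have e1 : frontier K ∩ {x | ∀ j, j ≠ i → 0 ≤ s j * x j} ∩
        {x | 0 ≤ ⟪x, EuclideanSpace.single i (s i)⟫} = S := by
      ext x
      simp only [hS, Set.mem_inter_iff, Set.mem_setOf_eq, hin, and_assoc]
      refine and_congr_right fun _ => ⟨fun h j => ?_, fun h => ⟨fun j _ => h j, h i⟩⟩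
      by_cases hj : j = i
      · subst hj; exact h.2
      · exact h.1 j hj
    have e2 : {x : EuclideanSpace ℝ (Fin 3) | ⟪x, EuclideanSpace.single i (s i)⟫ = 0} =
        {x | x i = 0} := by
      ext x
      simp [hin, hs0]
    rw [e1] at h1
    refine ⟨h1, ?_⟩
    rw [e1, e2, hsec i σ, ENNReal.toReal_div] at h2
    simp only [hin, integral_const_mul] at h2
    change _ = s i * _
    have h4 : (ENNReal.toReal 4) = 4 := by simp
    rw [h4] at h2
    rw [← h2, ← mul_assoc, hss, one_mul]
  ext i
  have hIntg := (key i).1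
  rw [eval_integral_piLp (fun j => hIntg.eval_piLp j), (key i).2]
  have fin : ∀ (m s : Fin 3 → ℝ), s i * (m i / 4) = ((1 / 4 : ℝ) • ∑ j : Fin 3,
      (m j * s j) • (EuclideanSpace.single j (1 : ℝ) : EuclideanSpace ℝ (Fin 3))) i := by
    intro m s
    fin_cases i <;> simp [Fin.sum_univ_three] <;> ring
  exact fin (fun j => (μH[2] (K ∩ {x : EuclideanSpace ℝ (Fin 3) | x j = 0})).toReal)
    (fun j => if σ j then (1 : ℝ) else -1)
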